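/- Let D = [-1/2,1/2]² and let L > √2. Let f : ℝ² → ℂ be smooth with support contained in D, and define F(s) = ∫_{ℝ²} e^{−i⟨s,y⟩} f(y) dy. Then for every x ∈ D, the two-dimensional logarithmic volume potential admits the spectral representation ∫_D (−(1/(2π)) log|x−y|) f(y) dy = (1/(2π)²) ∫_{ℝ²} e^{i⟨s,x⟩} [ (1 − J₀(L|s|))/|s|² − L log(L) J₁(L|s|)/|s| ] F(s) ds, the integrand on the right being absolutely integrable. -/

import Mathlib

open MeasureTheory RealInnerProductSpace

/-- The Bessel function of the first kind of integer order `n`, defined via its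
integral representation `J_n(x) = (1/π) ∫₀^π cos(nθ − x sin θ) dθ`. -/
noncomputable def besselJ (n : ℕ) (x : ℝ) : ℝ :=
  (1 / Real.pi) * ∫ θ in (0 : ℝ)..Real.pi, Real.cos (n * θ - x * Real.sin θ)

lemma hasDerivAt_besselJ (n : ℕ) (x : ℝ) :
    HasDerivAt (besselJ n)
      ((1 / Real.pi) * ∫ θ in (0 : ℝ)..Real.pi, Real.sin θ * Real.sin (n * θ - x * Real.sin θ))
      x := by
  unfold besselJ
  refine HasDerivAt.const_mul _ ?_
  refine (intervalIntegral.hasDerivAt_integral_of_dominated_loc_of_deriv_le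
    (F := fun x θ ↦ Real.cos (n * θ - x * Real.sin θ))
    (F' := fun x θ ↦ Real.sin θ * Real.sin (n * θ - x * Real.sin θ))
    (bound := fun _ ↦ 1) Filter.univ_mem ?_ ?_ ?_ ?_ ?_ ?_).2
  · exact .of_forall fun x ↦ Continuous.aestronglyMeasurable (by fun_prop)
  · exact Continuous.intervalIntegrable (by fun_prop) _ _
  · exact Continuous.aestronglyMeasurable (by fun_prop)
  · refine .of_forall fun θ _ x _ ↦ ?_
    rw [Real.norm_eq_abs, abs_mul]
    exact mul_le_one₀ (Real.abs_sin_le_one _) (abs_nonneg _) (Real.abs_sin_le_one _)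
  · exact intervalIntegrable_const
  · refine .of_forall fun θ _ x _ ↦ ?_
    refine (((hasDerivAt_id' x).mul_const (Real.sin θ)).const_sub (n * θ)).cos.congr_deriv ?_
    ring

lemma continuous_besselJ (n : ℕ) : Continuous (besselJ n) :=
  continuous_iff_continuousAt.2 fun x ↦ (hasDerivAt_besselJ n x).continuousAt

lemma besselJ_zero_zero : besselJ 0 0 = 1 := by
  simp [besselJ, Real.pi_ne_zero]

lemma hasDerivAt_besselJ_zero (x : ℝ) : HasDerivAt (besselJ 0) (-besselJ 1 x) x := by
  convert hasDerivAt_besselJ 0 x using 1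
  have hodd : ∫ θ in (0 : ℝ)..Real.pi, Real.cos θ * Real.cos (x * Real.sin θ) = 0 := by
    have h := intervalIntegral.integral_comp_sub_left (a := 0) (b := Real.pi)
      (fun θ ↦ Real.cos θ * Real.cos (x * Real.sin θ)) Real.pi
    simp only [Real.cos_pi_sub, Real.sin_pi_sub, sub_self, sub_zero, neg_mul,
      intervalIntegral.integral_neg] at h
    linarith
  have hsub : (∫ θ in (0 : ℝ)..Real.pi, Real.cos ((1 : ℕ) * θ - x * Real.sin θ)) +
      ∫ θ in (0 : ℝ)..Real.pi, Real.sin θ * Real.sin ((0 : ℕ) * θ - x * Real.sin θ) = 0 := by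
    rw [← intervalIntegral.integral_add (Continuous.intervalIntegrable (by fun_prop) _ _)
      (Continuous.intervalIntegrable (by fun_prop) _ _), ← hodd]
    congr 1
    ext θ
    simp [Real.cos_sub]
  rw [besselJ, eq_neg_of_add_eq_zero_left hsub]
  ring

lemma besselJ_one_add_mul_deriv (x : ℝ) :
    besselJ 1 x + x * ((1 / Real.pi) *
      ∫ θ in (0 : ℝ)..Real.pi, Real.sin θ * Real.sin ((1 : ℕ) * θ - x * Real.sin θ)) =
      x * besselJ 0 x := by
  have h : ∫ θ in (0 : ℝ)..Real.pi,
      Real.cos (θ - x * Real.sin θ) * (1 - x * Real.cos θ) = 0 := by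
    rw [intervalIntegral.integral_eq_sub_of_hasDerivAt
      (f := fun θ ↦ Real.sin (θ - x * Real.sin θ))
      (f' := fun θ ↦ Real.cos (θ - x * Real.sin θ) * (1 - x * Real.cos θ))
      (fun θ _ ↦ ((hasDerivAt_id' θ).fun_sub ((Real.hasDerivAt_sin θ).const_mul x)).sin)
      (Continuous.intervalIntegrable (by fun_prop) _ _)]
    simp
  have hsum : (∫ θ in (0 : ℝ)..Real.pi, Real.cos ((1 : ℕ) * θ - x * Real.sin θ)) +
      x * (∫ θ in (0 : ℝ)..Real.pi, Real.sin θ * Real.sin ((1 : ℕ) * θ - x * Real.sin θ)) -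
      x * (∫ θ in (0 : ℝ)..Real.pi, Real.cos ((0 : ℕ) * θ - x * Real.sin θ)) = 0 := by
    rw [← intervalIntegral.integral_const_mul, ← intervalIntegral.integral_const_mul,
      ← intervalIntegral.integral_add (Continuous.intervalIntegrable (by fun_prop) _ _)
        (Continuous.intervalIntegrable (by fun_prop) _ _),
      ← intervalIntegral.integral_sub (Continuous.intervalIntegrable (by fun_prop) _ _)
        (Continuous.intervalIntegrable (by fun_prop) _ _), ← h]
    congr 1
    ext θ
    have hθ : Real.cos ((0 : ℕ) * θ - x * Real.sin θ) =
        Real.cos (θ - x * Real.sin θ) * Real.cos θ + Real.sin (θ - x * Real.sin θ) * Real.sin θ := by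
      rw [← Real.cos_sub]
      congr 1
      simp
    rw [hθ]
    simp only [Nat.cast_one, one_mul]
    ring
  simp only [besselJ]
  linear_combination (1 / Real.pi) * hsum

/-- The radial Fourier integral of the truncated logarithm. -/
lemma integral_mul_log_mul_besselJ_zero {L ρ : ℝ} (hL : 0 < L) (hρ : ρ ≠ 0) :
    ∫ r in (0 : ℝ)..L, r * Real.log r * besselJ 0 (ρ * r) =
      L * Real.log L * besselJ 1 (L * ρ) / ρ - (1 - besselJ 0 (L * ρ)) / ρ ^ 2 := by
  have hJ := continuous_besselJ
  have hlog := Real.continuous_mul_log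
  rw [intervalIntegral.integral_eq_sub_of_hasDerivAt_of_le (f := fun r ↦
    r * Real.log r * besselJ 1 (ρ * r) / ρ + besselJ 0 (ρ * r) / ρ ^ 2) hL.le ?_ ?_ ?_]
  · simp only [mul_zero, zero_mul, besselJ_zero_zero, mul_comm L ρ]
    ring
  · have h0 := hJ 0
    have h1 := hJ 1
    fun_prop
  · intro r hr
    have hr0 : r ≠ 0 := hr.1.ne'
    have hlin : HasDerivAt (fun r ↦ ρ * r) ρ r := by
      simpa using (hasDerivAt_id r).const_mul ρ
    have h1 := ((Real.hasDerivAt_mul_log hr0).mul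
      ((hasDerivAt_besselJ 1 (ρ * r)).comp r hlin)).div_const ρ
    have h0 := ((hasDerivAt_besselJ_zero (ρ * r)).comp r hlin).div_const (ρ ^ 2)
    refine (h1.add h0).congr_deriv ?_
    have hb := besselJ_one_add_mul_deriv (ρ * r)
    simp only [Function.comp_apply]
    set A := (1 / Real.pi) *
      ∫ θ in (0 : ℝ)..Real.pi, Real.sin θ * Real.sin ((1 : ℕ) * θ - ρ * r * Real.sin θ)
    field_simp
    linear_combination Real.log r * hb
  · have h0 := hJ 0
    exact Continuous.intervalIntegrable (by fun_prop) _ _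

lemma integral_exp_cos_sub_eq_besselJ (a φ : ℝ) :
    ∫ θ in (-Real.pi)..Real.pi, Complex.exp (-(a * Real.cos (θ - φ) : ℝ) * Complex.I) =
      (2 * Real.pi * besselJ 0 a : ℝ) := by
  set g : ℝ → ℂ := fun θ ↦ Complex.exp (-(a * Real.sin θ : ℝ) * Complex.I)
  have hg : Continuous g := by fun_prop
  have hper : Function.Periodic g (2 * Real.pi) := fun θ ↦ by
    simp only [g, Real.sin_add_two_pi]
  have hshift : ∀ θ, Complex.exp (-(a * Real.cos (θ - φ) : ℝ) * Complex.I) =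
      g (θ + (Real.pi / 2 - φ)) := fun θ ↦ by
    simp only [g]
    rw [show θ + (Real.pi / 2 - φ) = θ - φ + Real.pi / 2 by ring, Real.sin_add_pi_div_two]
  have hfull : ∫ θ in (-Real.pi)..Real.pi, g (θ + (Real.pi / 2 - φ)) =
      ∫ θ in (-Real.pi)..Real.pi, g θ := by
    rw [intervalIntegral.integral_comp_add_right]
    convert hper.intervalIntegral_add_eq (-Real.pi + (Real.pi / 2 - φ)) (-Real.pi) using 2 <;> ring
  have hneg : ∫ θ in (-Real.pi)..0, g θ = ∫ θ in (0 : ℝ)..Real.pi, g (-θ) := by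
    simp [intervalIntegral.integral_comp_neg]
  simp_rw [hshift]
  rw [hfull, ← intervalIntegral.integral_add_adjacent_intervals
    (hg.intervalIntegrable (-Real.pi) 0) (hg.intervalIntegrable 0 Real.pi), hneg,
    ← intervalIntegral.integral_add (Continuous.intervalIntegrable (by fun_prop) _ _)
      (hg.intervalIntegrable _ _)]
  have hcos : ∀ θ, g (-θ) + g θ =
      ((2 * Real.cos ((0 : ℕ) * θ - a * Real.sin θ) : ℝ) : ℂ) := fun θ ↦ by
    simp [g, Complex.cos]
    ring_nf
  simp_rw [hcos]
  rw [intervalIntegral.integral_ofReal, intervalIntegral.integral_const_mul, besselJ]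
  congr 1
  field_simp

/-- The Fourier transform of a radial function in the plane is a Hankel transform. -/
lemma integral_exp_inner_mul_radial {k : ℝ → ℝ}
    (hk : IntegrableOn (fun r ↦ r * k r) (Set.Ioi 0)) (s : EuclideanSpace ℝ (Fin 2)) :
    ∫ z : EuclideanSpace ℝ (Fin 2), Complex.exp (-(⟪z, s⟫ : ℝ) * Complex.I) * (k ‖z‖ : ℂ) =
      ((2 * Real.pi * ∫ r in Set.Ioi (0 : ℝ), r * k r * besselJ 0 (‖s‖ * r) : ℝ) : ℂ) := by
  set U := Complex.orthonormalBasisOneI.repr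
  set σ : ℂ := U.symm s with hσ
  have hinner (r θ : ℝ) : ⟪U (r * (Real.cos θ + Real.sin θ * Complex.I)), s⟫ =
      ‖s‖ * r * Real.cos (θ - σ.arg) := by
    have hs : s = U σ := by simp [hσ]
    have hσ' : σ = ‖σ‖ * (Real.cos σ.arg + Real.sin σ.arg * Complex.I) := by
      simp
    rw [hs, LinearIsometryEquiv.inner_map_map, LinearIsometryEquiv.norm_map, Complex.inner]
    nth_rw 1 [hσ']
    rw [Real.cos_sub]
    have hre := Complex.norm_mul_cos_arg σ
    have him := Complex.norm_mul_sin_arg σ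
    simp [-Complex.ofReal_cos, -Complex.ofReal_sin]
    linear_combination -(r * Real.cos θ) * hre - r * Real.sin θ * him
  have hprod : IntegrableOn (fun p : ℝ × ℝ ↦
      ((p.1 * k p.1 : ℝ) : ℂ) * Complex.exp (-(‖s‖ * p.1 * Real.cos (p.2 - σ.arg) : ℝ) * Complex.I))
      (Set.Ioi 0 ×ˢ Set.Ioo (-Real.pi) Real.pi) := by
    have hc : IntegrableOn (fun _ : ℝ ↦ (1 : ℂ)) (Set.Ioo (-Real.pi) Real.pi) := by
      simp
    have h1 : IntegrableOn (fun p : ℝ × ℝ ↦ ((p.1 * k p.1 : ℝ) : ℂ) * 1)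
        (Set.Ioi 0 ×ˢ Set.Ioo (-Real.pi) Real.pi) := by
      rw [IntegrableOn, Measure.volume_eq_prod, ← Measure.prod_restrict]
      exact Integrable.mul_prod hk.ofReal hc
    simp only [mul_one] at h1
    refine h1.mul_bdd (c := 1) (Continuous.aestronglyMeasurable (by fun_prop))
      (.of_forall fun p ↦ ?_)
    rw [← Complex.ofReal_neg, Complex.norm_exp_ofReal_mul_I]
  rw [← U.measurePreserving.integral_comp U.toHomeomorph.measurableEmbedding,
    ← Complex.integral_comp_polarCoord_symm, polarCoord_target]
  calc _ = ∫ p in Set.Ioi 0 ×ˢ Set.Ioo (-Real.pi) Real.pi, ((p.1 * k p.1 : ℝ) : ℂ) *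
        Complex.exp (-(‖s‖ * p.1 * Real.cos (p.2 - σ.arg) : ℝ) * Complex.I) := by
        refine setIntegral_congr_fun (measurableSet_Ioi.prod measurableSet_Ioo) fun p hp ↦ ?_
        have hp1 : 0 < p.1 := hp.1
        simp only [Complex.polarCoord_symm_apply]
        rw [hinner, LinearIsometryEquiv.norm_map, ← Complex.polarCoord_symm_apply,
          Complex.norm_polarCoord_symm, abs_of_pos hp1]
        simp only [Complex.real_smul, Complex.ofReal_mul]
        ring
    _ = ∫ r in Set.Ioi (0 : ℝ), ((2 * Real.pi * (r * k r * besselJ 0 (‖s‖ * r)) : ℝ) : ℂ) := by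
        rw [Measure.volume_eq_prod, setIntegral_prod _ hprod]
        congr 1
        ext r
        dsimp only
        rw [integral_const_mul, ← integral_Ioc_eq_integral_Ioo,
          ← intervalIntegral.integral_of_le (by linarith [Real.pi_pos]),
          integral_exp_cos_sub_eq_besselJ, ← Complex.ofReal_mul]
        congr 1
        ring
    _ = _ := by
        rw [integral_complex_ofReal, integral_const_mul]

/-- The radial profile of the logarithmic kernel truncated to the disk of radius `L`. -/
noncomputable def truncatedLog (L : ℝ) : ℝ → ℝ :=
  (Set.Iic L).indicator fun r ↦ -(1 / (2 * Real.pi)) * Real.log r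

lemma truncatedLog_of_le {L r : ℝ} (h : r ≤ L) :
    truncatedLog L r = -(1 / (2 * Real.pi)) * Real.log r :=
  Set.indicator_of_mem (Set.mem_Iic.2 h) _

lemma mul_truncatedLog (L r : ℝ) : r * truncatedLog L r =
    (Set.Iic L).indicator (fun r ↦ -(1 / (2 * Real.pi)) * (r * Real.log r)) r := by
  by_cases h : r ∈ Set.Iic L
  · simp only [truncatedLog, Set.indicator_of_mem h]
    ring
  · simp [truncatedLog, Set.indicator_of_notMem h]

lemma integrableOn_mul_truncatedLog (L : ℝ) :
    IntegrableOn (fun r ↦ r * truncatedLog L r) (Set.Ioi 0) := by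
  simp only [mul_truncatedLog]
  rw [integrableOn_indicator_iff measurableSet_Iic, Set.inter_comm, Set.Ioi_inter_Iic]
  exact ((Real.continuous_mul_log.const_mul _).integrableOn_Icc).mono_set Set.Ioc_subset_Icc_self

lemma integrable_truncatedLog_norm (L : ℝ) :
    Integrable fun z : EuclideanSpace ℝ (Fin 2) ↦ (truncatedLog L ‖z‖ : ℂ) := by
  refine Integrable.ofReal (f := fun z : EuclideanSpace ℝ (Fin 2) ↦ truncatedLog L ‖z‖) ?_
  rw [integrable_fun_norm_addHaar]
  simpa using integrableOn_mul_truncatedLog L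

/-- The Fourier transform of the logarithmic kernel truncated to the disk of radius `L`. -/
lemma integral_exp_inner_mul_truncatedLog {L : ℝ} (hL : 0 < L) {s : EuclideanSpace ℝ (Fin 2)}
    (hs : s ≠ 0) :
    ∫ z : EuclideanSpace ℝ (Fin 2),
        Complex.exp (-(⟪z, s⟫ : ℝ) * Complex.I) * (truncatedLog L ‖z‖ : ℂ) =
      (((1 - besselJ 0 (L * ‖s‖)) / ‖s‖ ^ 2 -
        L * Real.log L * besselJ 1 (L * ‖s‖) / ‖s‖ : ℝ) : ℂ) := by
  rw [integral_exp_inner_mul_radial (integrableOn_mul_truncatedLog L)]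
  congr 1
  have h : ∀ r, r * truncatedLog L r * besselJ 0 (‖s‖ * r) = (Set.Iic L).indicator
      (fun r ↦ -(1 / (2 * Real.pi)) * (r * Real.log r * besselJ 0 (‖s‖ * r))) r := fun r ↦ by
    rw [mul_truncatedLog,
      ← Set.indicator_mul_left (Set.Iic L) _ fun r ↦ besselJ 0 (‖s‖ * r)]
    simp only [mul_assoc]
  simp_rw [h]
  rw [setIntegral_indicator measurableSet_Iic, Set.Ioi_inter_Iic, integral_const_mul,
    ← intervalIntegral.integral_of_le hL.le,
    integral_mul_log_mul_besselJ_zero hL (norm_ne_zero_iff.2 hs)]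
  field_simp
  ring

lemma fourier_inv_two_pi_smul {V : Type*} [NormedAddCommGroup V] [InnerProductSpace ℝ V]
    [MeasurableSpace V] [BorelSpace V] [FiniteDimensional ℝ V] (f : V → ℂ) (s : V) :
    FourierTransform.fourier f ((2 * Real.pi)⁻¹ • s) =
      ∫ y, Complex.exp (-Complex.I * (⟪s, y⟫ : ℂ)) * f y := by
  rw [Real.fourier_eq']
  congr 1
  ext y
  rw [inner_smul_right, real_inner_comm, smul_eq_mul]
  congr 2
  push_cast
  field_simp

lemma SchwartzMap.integrable_unnormalized_fourier {V : Type*} [NormedAddCommGroup V]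
    [InnerProductSpace ℝ V] [MeasurableSpace V] [BorelSpace V] [FiniteDimensional ℝ V]
    (f : SchwartzMap V ℂ) :
    Integrable fun s : V ↦ ∫ y, Complex.exp (-Complex.I * (⟪s, y⟫ : ℂ)) * f y := by
  simp_rw [← fourier_inv_two_pi_smul, ← SchwartzMap.fourier_coe]
  exact (SchwartzMap.integrable _).comp_smul (by positivity)

/-- Fourier inversion in the plane with the non-unitary angular-frequency convention. -/
lemma SchwartzMap.integral_exp_inner_mul_unnormalized_fourier
    (f : SchwartzMap (EuclideanSpace ℝ (Fin 2)) ℂ) (z : EuclideanSpace ℝ (Fin 2)) :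
    ∫ s : EuclideanSpace ℝ (Fin 2), Complex.exp (Complex.I * (⟪s, z⟫ : ℂ)) *
        ∫ y, Complex.exp (-Complex.I * (⟪s, y⟫ : ℂ)) * f y =
      ((2 * Real.pi) ^ 2 : ℝ) * f z := by
  have hinv : FourierTransformInv.fourierInv (FourierTransform.fourier (f : _ → ℂ)) z = f z := by
    rw [f.continuous.fourierInv_fourier_eq f.integrable]
    rw [← SchwartzMap.fourier_coe]
    exact SchwartzMap.integrable _
  rw [← hinv, Real.fourierInv_eq']
  have h := Measure.integral_comp_smul (volume : Measure (EuclideanSpace ℝ (Fin 2)))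
    (fun v ↦ Complex.exp (((2 * Real.pi * ⟪v, z⟫ : ℝ) : ℂ) * Complex.I) •
      FourierTransform.fourier (f : _ → ℂ) v) (2 * Real.pi)⁻¹
  have hpi := Real.pi_pos
  rw [finrank_euclideanSpace_fin, inv_pow, inv_inv, abs_of_pos (by positivity)] at h
  rw [← Complex.real_smul, ← h]
  congr 1
  ext s
  rw [fourier_inv_two_pi_smul, smul_eq_mul, inner_smul_left]
  congr 2
  simp
  field_simp

/-- Spectral representation of the 2D logarithmic volume potential on the unit box using
the truncated kernel: for smooth `f` supported in `D = [-1/2,1/2]²` and `L > √2`, and all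
`x ∈ D`,
`∫_D (−(1/2π) log|x−y|) f(y) dy
  = (1/(2π)²) ∫_{ℝ²} e^{i⟨s,x⟩} [(1 − J₀(L|s|))/|s|² − L log(L) J₁(L|s|)/|s|] F(s) ds`,
the integrand on the right being absolutely integrable. -/
theorem stmt_13 (L : ℝ) (hL : Real.sqrt 2 < L)
    (D : Set (EuclideanSpace ℝ (Fin 2)))
    (hD : D = {y : EuclideanSpace ℝ (Fin 2) | ∀ i, y i ∈ Set.Icc (-(1 / 2) : ℝ) (1 / 2)})
    (f : EuclideanSpace ℝ (Fin 2) → ℂ)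
    (hf : ContDiff ℝ (⊤ : ℕ∞) f) (hsupp : Function.support f ⊆ D)
    (F : EuclideanSpace ℝ (Fin 2) → ℂ)
    (hF : ∀ s, F s = ∫ y, Complex.exp (-Complex.I * (⟪s, y⟫ : ℂ)) * f y)
    (x : EuclideanSpace ℝ (Fin 2)) (hx : x ∈ D) :
    Integrable (fun s : EuclideanSpace ℝ (Fin 2) =>
        Complex.exp (Complex.I * (⟪s, x⟫ : ℂ)) *
          (((1 - besselJ 0 (L * ‖s‖)) / ‖s‖ ^ 2 -
              L * Real.log L * besselJ 1 (L * ‖s‖) / ‖s‖ : ℝ) : ℂ) * F s) ∧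
    ∫ y in D, ((-(1 / (2 * Real.pi)) * Real.log ‖x - y‖ : ℝ) : ℂ) * f y =
      ((1 / (2 * Real.pi) ^ 2 : ℝ) : ℂ) *
        ∫ s, Complex.exp (Complex.I * (⟪s, x⟫ : ℂ)) *
          (((1 - besselJ 0 (L * ‖s‖)) / ‖s‖ ^ 2 -
              L * Real.log L * besselJ 1 (L * ‖s‖) / ‖s‖ : ℝ) : ℂ) * F s := by
  have hL0 : 0 < L := (Real.sqrt_nonneg 2).trans_lt hL
  have hdist : ∀ y ∈ D, ‖x - y‖ ≤ √2 := fun y hy ↦ by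
    rw [hD] at hx hy
    have key : ∀ i, ‖(x - y) i‖ ^ 2 ≤ 1 := fun i ↦ by
      have h1 := hx i
      have h2 := hy i
      rw [PiLp.sub_apply, Real.norm_eq_abs, sq_abs]
      nlinarith [h1.1, h1.2, h2.1, h2.2]
    rw [EuclideanSpace.norm_eq, Fin.sum_univ_two]
    exact Real.sqrt_le_sqrt (by linarith [key 0, key 1])
  have hDclosed : IsClosed D := by
    rw [hD, Set.ofPred_forall]
    exact isClosed_iInter fun i ↦ isClosed_Icc.preimage (by fun_prop)
  have hDcompact : IsCompact D := by
    refine (isCompact_closedBall x √2).of_isClosed_subset hDclosed fun y hy ↦ ?_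
    rw [Metric.mem_closedBall, dist_comm, dist_eq_norm]
    exact hdist y hy
  have hf0 : ∀ y ∉ D, f y = 0 := fun y hy ↦ Function.notMem_support.1 fun h ↦ hy (hsupp h)
  have hcs : HasCompactSupport f := HasCompactSupport.intro hDcompact hf0
  let φ := hcs.toSchwartzMap hf
  have hφ : ∀ y, φ y = f y := fun _ ↦ rfl
  have hFint : Integrable F := by
    rw [show F = _ from funext hF]
    exact φ.integrable_unnormalized_fourier
  set K : EuclideanSpace ℝ (Fin 2) → ℂ := fun z ↦ (truncatedLog L ‖z‖ : ℂ)
  have hK : Integrable K := integrable_truncatedLog_norm L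
  set g : EuclideanSpace ℝ (Fin 2) → ℂ := fun s ↦ Complex.exp (Complex.I * (⟪s, x⟫ : ℂ)) * F s
  have hg : Integrable g := by
    refine hFint.bdd_mul (c := 1) (Continuous.aestronglyMeasurable (by fun_prop))
      (.of_forall fun s ↦ ?_)
    rw [mul_comm, Complex.norm_exp_ofReal_mul_I]
  have hinner : Continuous fun p : EuclideanSpace ℝ (Fin 2) × EuclideanSpace ℝ (Fin 2) ↦
      innerₗ (EuclideanSpace ℝ (Fin 2)) p.1 p.2 := by
    simp only [innerₗ_apply_apply]
    fun_prop
  set K' := VectorFourier.fourierIntegral Real.probChar volume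
    (innerₗ (EuclideanSpace ℝ (Fin 2))) K
  have hK'cont : Continuous K' :=
    VectorFourier.fourierIntegral_continuous Real.continuous_probChar hinner hK
  have hae : (fun s ↦ K' s * g s) =ᵐ[volume] fun s : EuclideanSpace ℝ (Fin 2) ↦
      Complex.exp (Complex.I * (⟪s, x⟫ : ℂ)) *
          (((1 - besselJ 0 (L * ‖s‖)) / ‖s‖ ^ 2 -
              L * Real.log L * besselJ 1 (L * ‖s‖) / ‖s‖ : ℝ) : ℂ) * F s := by
    filter_upwards [Measure.ae_ne volume 0] with s hs
    simp only [K', g, VectorFourier.fourierIntegral_probChar, innerₗ_apply_apply, smul_eq_mul]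
    rw [integral_exp_inner_mul_truncatedLog hL0 hs]
    ring
  have hflip := VectorFourier.integral_fourierIntegral_smul_eq_flip (μ := volume) (ν := volume)
    Real.continuous_probChar hinner hK hg
  refine ⟨(hg.bdd_mul hK'cont.aestronglyMeasurable (.of_forall fun s ↦
    VectorFourier.norm_fourierIntegral_le_integral_norm _ _ _ _ s)).congr hae, ?_⟩
  rw [← integral_congr_ae hae]
  simp only [smul_eq_mul] at hflip
  rw [hflip]
  have hinv : ∀ z, VectorFourier.fourierIntegral Real.probChar volume
      (innerₗ (EuclideanSpace ℝ (Fin 2))).flip g z = ((2 * Real.pi) ^ 2 : ℝ) * f (x - z) := by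
    intro z
    rw [VectorFourier.fourierIntegral_probChar, ← hφ,
      ← SchwartzMap.integral_exp_inner_mul_unnormalized_fourier]
    congr 1
    ext s
    simp only [LinearMap.flip_apply, innerₗ_apply_apply, smul_eq_mul, g, hφ, ← hF]
    rw [← mul_assoc, ← Complex.exp_add, inner_sub_right, real_inner_comm]
    congr 2
    push_cast
    ring
  simp_rw [hinv]
  have hpi : ((2 * Real.pi) ^ 2 : ℝ) ≠ 0 := by positivity
  rw [← integral_const_mul, ← integral_sub_left_eq_self _ volume x,
    setIntegral_eq_integral_of_forall_compl_eq_zero fun y hy ↦ by rw [hf0 y hy, mul_zero]]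
  congr 1
  ext y
  rw [sub_sub_cancel]
  by_cases hy : y ∈ D
  · simp only [K]
    rw [truncatedLog_of_le ((hdist y hy).trans hL.le), one_div (_ ^ 2), Complex.ofReal_inv]
    have hpi' := Complex.ofReal_ne_zero.2 hpi
    field_simp
  · simp [hf0 y hy]
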